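/- arXiv:2210.08591 — 3 statements merged into one kernel-verified Lean document; each statement's English description precedes it below -/
import Mathlib

section
/- (Linear-quadratic regime: the quadratic ansatz solves the prelimit HJB equation.) Let $N \ge 1$, $d \ge 1$, $T > 0$, $b_0, p_1, \sigma \in \mathbb{R}^d$, $p_2 \in \mathbb{R}$, and $B, \bar B, P_2, \bar P_2 \in \mathbb{R}^{d\times d}$ with $P_2, \bar P_2$ symmetric. Suppose $\tilde\Lambda, \tilde\Gamma : [0,T] \to \mathbb{R}^{d\times d}$ take symmetric values, and together with $\tilde\gamma : [0,T] \to \mathbb{R}^d$ and $\tilde\chi : [0,T] \to \mathbb{R}$ are differentiable and satisfy on $[0,T]$ the Riccati system: $\tilde\Lambda' + \tilde\Lambda B + B^\top \tilde\Lambda - 2\tilde\Lambda \sigma\sigma^\top \tilde\Lambda^\top = 0$ with $\tilde\Lambda(T) = P_2$; $\tilde\Gamma' + \tilde\Gamma(B+\bar B) + (B+\bar B)^\top \tilde\Gamma - 2\tilde\Gamma \sigma\sigma^\top \tilde\Gamma^\top = 0$ with $\tilde\Gamma(T) = P_2 + \bar P_2$; $\tilde\gamma' + (B+\bar B)^\top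 \tilde\gamma - 2\tilde\Gamma \sigma\sigma^\top \tilde\gamma + 2\tilde\Gamma b_0 = 0$ with $\tilde\gamma(T) = p_1$; and $\tilde\chi' - \tfrac{1}{2}\tilde\gamma^\top \sigma\sigma^\top \tilde\gamma + \tilde\gamma \cdot b_0 + \sigma^\top \tilde\Lambda \sigma + \tfrac{1}{N}\sigma^\top(\tilde\Gamma - \tilde\Lambda)\sigma = 0$ with $\tilde\chi(T) = p_2$. Define $\tilde\Phi : [0,T] \times (\mathbb{R}^d)^N \to \mathbb{R}$ by $\tilde\Phi(t,x) := \frac{1}{N}\sum_{i=1}^N x_i^\top \tilde\Lambda(t) x_i + \bar x^\top(\tilde\Gamma(t) - \tilde\Lambda(t))\bar x + \tilde\gamma(t) \cdot \bar x + \tilde\chi(t)$, where $\bar x := \frac{1}{N}\sum_{i=1}^N x_i$. Then for all $t \in [0,T]$ and all $x \in (\mathbb{R}^d)^N$: $-\partial_t\tilde\Phi(t,x) - \sum_{i=1}^N \big[ (b_0 + B x_i + \bar B \bar x) \cdot \partial_{x_i}\tilde\Phi(t,x) - \tfrac{N}{2}\big(\sigma \cdot \partial_{x_i}\tilde\Phi(t,x)\big)^2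 + \tfrac{1}{2}\sigma^\top \big(\partial^2_{x_i}\tilde\Phi(t,x)\big)\sigma \big] = 0$, and $\tilde\Phi(T,x) = \frac{1}{N}\sum_{i=1}^N \big( x_i^\top P_2 x_i + p_1 \cdot x_i \big) + \bar x^\top \bar P_2 \bar x + p_2$. -/
open Matrix Set

/-- The linear-quadratic ansatz
`Φ̃(t,x) = (1/N) ∑ᵢ xᵢᵀ Λ̃(t) xᵢ + x̄ᵀ(Γ̃(t)-Λ̃(t))x̄ + γ̃(t)·x̄ + χ̃(t)`,
the empirical projection of the linear-quadratic value function. -/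
noncomputable def lqAnsatz {N d : ℕ} (Λ Γ : ℝ → Matrix (Fin d) (Fin d) ℝ)
    (γ : ℝ → Fin d → ℝ) (χ : ℝ → ℝ) (t : ℝ) (x : Fin N → Fin d → ℝ) : ℝ :=
  (1/(N:ℝ)) * ∑ i, (x i) ⬝ᵥ (Λ t).mulVec (x i)
    + ((N:ℝ)⁻¹ • ∑ i, x i) ⬝ᵥ ((Γ t - Λ t).mulVec ((N:ℝ)⁻¹ • ∑ i, x i))
    + (γ t) ⬝ᵥ ((N:ℝ)⁻¹ • ∑ i, x i) + χ t

theorem HasDerivAt.dotProduct {n : Type*} [Fintype n] {u v : ℝ → n → ℝ} {u' v' : n → ℝ} {t : ℝ}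
    (hu : HasDerivAt u u' t) (hv : HasDerivAt v v' t) :
    HasDerivAt (fun s => u s ⬝ᵥ v s) (u' ⬝ᵥ v t + u t ⬝ᵥ v') t := by
  simp only [_root_.dotProduct, ← Finset.sum_add_distrib]
  exact HasDerivAt.fun_sum fun i _ => (hasDerivAt_pi.1 hu i).mul (hasDerivAt_pi.1 hv i)

theorem HasDerivAt.mulVec_const {m n : Type*} [Fintype m] [Fintype n] {A : ℝ → Matrix m n ℝ}
    {A' : Matrix m n ℝ} {t : ℝ} (hA : ∀ i j, HasDerivAt (fun s => A s i j) (A' i j) t)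
    (v : n → ℝ) : HasDerivAt (fun s => (A s).mulVec v) (A'.mulVec v) t :=
  hasDerivAt_pi.2 fun i => by
    simpa [mulVec] using (hasDerivAt_pi.2 (hA i)).dotProduct (hasDerivAt_const t v)

theorem HasDerivAt.const_mulVec {m n : Type*} [Fintype m] [Fintype n] (A : Matrix m n ℝ)
    {v : ℝ → n → ℝ} {v' : n → ℝ} {t : ℝ} (hv : HasDerivAt v v' t) :
    HasDerivAt (fun s => A.mulVec (v s)) (A.mulVec v') t :=
  hasDerivAt_pi.2 fun i => by
    simpa [mulVec] using (hasDerivAt_const t (A i)).dotProduct hv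

/-- The derivative of the coordinate line through `x` in direction `(i, k)`, block by block. -/
theorem hasDerivAt_update_update {ι n : Type*} [Fintype ι] [DecidableEq ι] [Fintype n]
    [DecidableEq n] (x : ι → n → ℝ) (i : ι) (k : n) (a : ℝ) (j : ι) :
    HasDerivAt (fun a => Function.update x i (Function.update (x i) k a) j)
      ((Pi.single i (Pi.single k 1) : ι → n → ℝ) j) a := by
  obtain rfl | h := eq_or_ne j i
  · simpa using hasDerivAt_update (x j) k a
  · simpa [h] using hasDerivAt_const a (x j)

theorem Matrix.IsSymm.dotProduct_mulVec_comm {n : Type*} [Fintype n] {A : Matrix n n ℝ}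
    (hA : A.IsSymm) (u v : n → ℝ) : u ⬝ᵥ A.mulVec v = v ⬝ᵥ A.mulVec u := by
  rw [dotProduct_mulVec, ← mulVec_transpose, hA.eq, dotProduct_comm]

theorem dotProduct_mulVec_mulVec_vecMulVec {n : Type*} [Fintype n] (σ u v : n → ℝ) :
    u ⬝ᵥ (vecMulVec σ σ).mulVec v = (σ ⬝ᵥ u) * (σ ⬝ᵥ v) := by
  rw [vecMulVec_mulVec, dotProduct_smul, dotProduct_comm u]
  simp

/-- The quadratic form of a Riccati right-hand side. -/
theorem dotProduct_mulVec_of_riccati {n : Type*} [Fintype n] {A' A C : Matrix n n ℝ}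
    (hA : A.IsSymm) (σ : n → ℝ)
    (h : A' + A * C + Cᵀ * A - (2:ℝ) • (A * vecMulVec σ σ * Aᵀ) = 0) (v : n → ℝ) :
    v ⬝ᵥ A'.mulVec v = 2 * (σ ⬝ᵥ A.mulVec v) ^ 2 - 2 * (C.mulVec v ⬝ᵥ A.mulVec v) := by
  have h2 := congrArg (fun M : Matrix n n ℝ => v ⬝ᵥ M.mulVec v) h
  simp only [hA.eq, sub_mulVec, add_mulVec, smul_mulVec, ← mulVec_mulVec, dotProduct_sub,
    dotProduct_add, dotProduct_smul, zero_mulVec, dotProduct_zero, smul_eq_mul] at h2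
  rw [hA.dotProduct_mulVec_comm v (C.mulVec v), dotProduct_mulVec v Cᵀ, vecMul_transpose,
    hA.dotProduct_mulVec_comm v, dotProduct_comm ((vecMulVec σ σ).mulVec _),
    dotProduct_mulVec_mulVec_vecMulVec] at h2
  linarith

/-- The `i`-th block gradient of the linear-quadratic ansatz. -/
noncomputable def lqAnsatzGrad {N d : ℕ} (Λ Γ : ℝ → Matrix (Fin d) (Fin d) ℝ)
    (γ : ℝ → Fin d → ℝ) (t : ℝ) (x : Fin N → Fin d → ℝ) (i : Fin N) : Fin d → ℝ :=
  (N:ℝ)⁻¹ • ((2:ℝ) • (Λ t).mulVec (x i)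
    + (2:ℝ) • (Γ t - Λ t).mulVec ((N:ℝ)⁻¹ • ∑ j, x j) + γ t)

/-- The diagonal block Hessian of the linear-quadratic ansatz. -/
noncomputable def lqAnsatzHess {d : ℕ} (N : ℕ) (Λ Γ : ℝ → Matrix (Fin d) (Fin d) ℝ) (t : ℝ) :
    Matrix (Fin d) (Fin d) ℝ :=
  (N:ℝ)⁻¹ • ((2:ℝ) • Λ t + (2 * (N:ℝ)⁻¹) • (Γ t - Λ t))

theorem hasDerivAt_mean_update {N d : ℕ} (x : Fin N → Fin d → ℝ) (i : Fin N) (k : Fin d) (a : ℝ) :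
    HasDerivAt (fun a => (N:ℝ)⁻¹ • ∑ j, Function.update x i (Function.update (x i) k a) j)
      ((N:ℝ)⁻¹ • Pi.single k 1) a := by
  have h := (HasDerivAt.fun_sum fun j (_ : j ∈ Finset.univ) =>
    hasDerivAt_update_update x i k a j).const_smul ((N:ℝ)⁻¹)
  refine h.congr_deriv ?_
  rw [Finset.sum_eq_single i (by intro j _ hj; simp [hj]) (by simp), Pi.single_eq_same]

theorem hasDerivAt_lqAnsatz_update {N d : ℕ} {Λ Γ : ℝ → Matrix (Fin d) (Fin d) ℝ}
    {γ : ℝ → Fin d → ℝ} {χ : ℝ → ℝ} {t : ℝ} (hΛ : (Λ t).IsSymm) (hΓ : (Γ t).IsSymm)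
    (x : Fin N → Fin d → ℝ) (i : Fin N) (k : Fin d) :
    HasDerivAt (fun a => lqAnsatz Λ Γ γ χ t
        (Function.update x i (Function.update (x i) k a)))
      (lqAnsatzGrad Λ Γ γ t x i k) (x i k) := by
  have hc := hasDerivAt_update_update x i k (x i k)
  have hm := hasDerivAt_mean_update x i k (x i k)
  have h := (((HasDerivAt.fun_sum fun j (_ : j ∈ Finset.univ) =>
    (hc j).dotProduct ((hc j).const_mulVec (Λ t))).const_mul (1 / (N:ℝ))).add
    (hm.dotProduct (hm.const_mulVec (Γ t - Λ t)))).add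
    ((hasDerivAt_const (x i k) (γ t)).dotProduct hm) |>.add_const (χ t)
  refine h.congr_deriv ?_
  simp only [Function.update_eq_self]
  rw [Finset.sum_eq_single i (by intro j _ hj; simp [hj]) (by simp), Pi.single_eq_same,
    hΛ.dotProduct_mulVec_comm (x i),
    (hΓ.sub hΛ).dotProduct_mulVec_comm _ ((N:ℝ)⁻¹ • Pi.single k 1)]
  simp [lqAnsatzGrad]
  ring

theorem hasDerivAt_lqAnsatzGrad_update {N d : ℕ} (Λ Γ : ℝ → Matrix (Fin d) (Fin d) ℝ)
    (γ : ℝ → Fin d → ℝ) (t : ℝ) (x : Fin N → Fin d → ℝ) (i : Fin N) (k l : Fin d) :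
    HasDerivAt (fun a => lqAnsatzGrad Λ Γ γ t
        (Function.update x i (Function.update (x i) l a)) i k)
      (lqAnsatzHess N Λ Γ t k l) (x i l) := by
  have hc := hasDerivAt_update_update x i l (x i l) i
  have hm := hasDerivAt_mean_update x i l (x i l)
  have h := ((((hc.const_mulVec (Λ t)).const_smul (2:ℝ)).add
    ((hm.const_mulVec (Γ t - Λ t)).const_smul (2:ℝ))).add_const (γ t)).const_smul ((N:ℝ)⁻¹)
  refine (hasDerivAt_pi.1 h k).congr_deriv ?_
  simp [lqAnsatzHess, mulVec_smul]
  exact Or.inl (by ring)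

theorem sum_dotProduct_mulVec_eq_mean {N d : ℕ} (hN : (N:ℝ) ≠ 0) (x : Fin N → Fin d → ℝ)
    (A : Matrix (Fin d) (Fin d) ℝ) (w : Fin d → ℝ) :
    ∑ i, w ⬝ᵥ A.mulVec (x i) = N * (w ⬝ᵥ A.mulVec ((N:ℝ)⁻¹ • ∑ i, x i)) := by
  simp only [dotProduct_mulVec]
  rw [← dotProduct_sum, dotProduct_smul, smul_eq_mul, mul_inv_cancel_left₀ hN]

/-- Linear-quadratic regime: the quadratic ansatz solves the prelimit HJB
equation.  If `Λ̃, Γ̃, γ̃, χ̃` solve the Riccati system, then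
`Φ̃(t,x) = (1/N)∑ᵢ xᵢᵀΛ̃(t)xᵢ + x̄ᵀ(Γ̃(t)-Λ̃(t))x̄ + γ̃(t)·x̄ + χ̃(t)` solves the prelimit HJB
equation for the linear-quadratic particle system, with the prescribed terminal condition. -/
theorem lq_ansatz_solves_prelimit_HJB
    (N d : ℕ) (hN : 1 ≤ N) (hd : 1 ≤ d) (T : ℝ) (hT : 0 < T)
    (b0 p1 σ : Fin d → ℝ) (p2 : ℝ)
    (B Bbar P2 P2bar : Matrix (Fin d) (Fin d) ℝ)
    (hP2 : P2.IsSymm) (hP2bar : P2bar.IsSymm)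
    (Λ Γ : ℝ → Matrix (Fin d) (Fin d) ℝ) (γ : ℝ → Fin d → ℝ) (χ : ℝ → ℝ)
    (hΛsymm : ∀ t, (Λ t).IsSymm) (hΓsymm : ∀ t, (Γ t).IsSymm)
    -- derivative data for Λ̃, Γ̃, γ̃, χ̃
    (Λ' Γ' : ℝ → Matrix (Fin d) (Fin d) ℝ) (γ' : ℝ → Fin d → ℝ) (χ' : ℝ → ℝ)
    (hΛd : ∀ t ∈ Icc (0:ℝ) T, ∀ i j, HasDerivAt (fun s => Λ s i j) (Λ' t i j) t)
    (hΓd : ∀ t ∈ Icc (0:ℝ) T, ∀ i j, HasDerivAt (fun s => Γ s i j) (Γ' t i j) t)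
    (hγd : ∀ t ∈ Icc (0:ℝ) T, ∀ i, HasDerivAt (fun s => γ s i) (γ' t i) t)
    (hχd : ∀ t ∈ Icc (0:ℝ) T, HasDerivAt χ (χ' t) t)
    -- the Riccati system
    (hΛeq : ∀ t ∈ Icc (0:ℝ) T,
      Λ' t + Λ t * B + Bᵀ * Λ t - (2:ℝ) • (Λ t * vecMulVec σ σ * (Λ t)ᵀ) = 0)
    (hΛT : Λ T = P2)
    (hΓeq : ∀ t ∈ Icc (0:ℝ) T,
      Γ' t + Γ t * (B + Bbar) + (B + Bbar)ᵀ * Γ t - (2:ℝ) • (Γ t * vecMulVec σ σ * (Γ t)ᵀ) = 0)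
    (hΓT : Γ T = P2 + P2bar)
    (hγeq : ∀ t ∈ Icc (0:ℝ) T,
      γ' t + (B + Bbar)ᵀ.mulVec (γ t) - (2:ℝ) • (Γ t * vecMulVec σ σ).mulVec (γ t)
        + (2:ℝ) • (Γ t).mulVec b0 = 0)
    (hγT : γ T = p1)
    (hχeq : ∀ t ∈ Icc (0:ℝ) T,
      χ' t - (1/2) * ((γ t) ⬝ᵥ (vecMulVec σ σ).mulVec (γ t)) + (γ t) ⬝ᵥ b0
        + σ ⬝ᵥ (Λ t).mulVec σ + (1/(N:ℝ)) * (σ ⬝ᵥ (Γ t - Λ t).mulVec σ) = 0)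
    (hχT : χ T = p2) :
    -- Φ̃ is differentiable and satisfies the prelimit HJB equation on [0,T]
    (∃ (dtΦ : ℝ → (Fin N → Fin d → ℝ) → ℝ)
       (gradΦ : ℝ → (Fin N → Fin d → ℝ) → Fin N → (Fin d → ℝ))
       (hessΦ : ℝ → (Fin N → Fin d → ℝ) → Fin N → Matrix (Fin d) (Fin d) ℝ),
      (∀ t ∈ Icc (0:ℝ) T, ∀ x,
        HasDerivAt (fun s => lqAnsatz (N := N) Λ Γ γ χ s x) (dtΦ t x) t) ∧
      (∀ t ∈ Icc (0:ℝ) T, ∀ x (i : Fin N) (k : Fin d),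
        HasDerivAt (fun a => lqAnsatz (N := N) Λ Γ γ χ t
            (Function.update x i (Function.update (x i) k a)))
          (gradΦ t x i k) (x i k)) ∧
      (∀ t ∈ Icc (0:ℝ) T, ∀ x (i : Fin N) (k l : Fin d),
        HasDerivAt (fun a => gradΦ t (Function.update x i (Function.update (x i) l a)) i k)
          (hessΦ t x i k l) (x i l)) ∧
      (∀ t ∈ Icc (0:ℝ) T, ∀ x : Fin N → Fin d → ℝ,
        -dtΦ t x - ∑ i,
          ((b0 + B.mulVec (x i) + Bbar.mulVec ((N:ℝ)⁻¹ • ∑ j, x j)) ⬝ᵥ gradΦ t x i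
            - ((N:ℝ)/2) * (σ ⬝ᵥ gradΦ t x i)^2
            + (1/2) * (σ ⬝ᵥ (hessΦ t x i).mulVec σ)) = 0)) ∧
    -- the terminal condition
    (∀ x : Fin N → Fin d → ℝ,
      lqAnsatz (N := N) Λ Γ γ χ T x
        = (1/(N:ℝ)) * ∑ i, ((x i) ⬝ᵥ P2.mulVec (x i) + p1 ⬝ᵥ (x i))
          + ((N:ℝ)⁻¹ • ∑ i, x i) ⬝ᵥ P2bar.mulVec ((N:ℝ)⁻¹ • ∑ i, x i) + p2) := by
  have hN0 : (N:ℝ) ≠ 0 := by positivity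
  refine ⟨⟨fun t x => (1/(N:ℝ)) * ∑ i, (x i) ⬝ᵥ (Λ' t).mulVec (x i)
      + ((N:ℝ)⁻¹ • ∑ i, x i) ⬝ᵥ ((Γ' t - Λ' t).mulVec ((N:ℝ)⁻¹ • ∑ i, x i))
      + (γ' t) ⬝ᵥ ((N:ℝ)⁻¹ • ∑ i, x i) + χ' t,
    lqAnsatzGrad Λ Γ γ, fun t _ _ => lqAnsatzHess N Λ Γ t, fun t ht x => ?_,
    fun t _ => hasDerivAt_lqAnsatz_update (hΛsymm t) (hΓsymm t),
    fun t _ => hasDerivAt_lqAnsatzGrad_update Λ Γ γ t, fun t ht x => ?_⟩, fun x => ?_⟩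
  · set m := (N:ℝ)⁻¹ • ∑ i, x i with hm
    have hq {A : ℝ → Matrix (Fin d) (Fin d) ℝ} {A' : Matrix (Fin d) (Fin d) ℝ}
        (hA : ∀ i j, HasDerivAt (fun s => A s i j) (A' i j) t) (v : Fin d → ℝ) :
        HasDerivAt (fun s => v ⬝ᵥ (A s).mulVec v) (v ⬝ᵥ A'.mulVec v) t := by
      simpa using (hasDerivAt_const t v).dotProduct (HasDerivAt.mulVec_const hA v)
    have hγm : HasDerivAt (fun s => γ s ⬝ᵥ m) (γ' t ⬝ᵥ m) t := by
      simpa using (hasDerivAt_pi.2 (hγd t ht)).dotProduct (hasDerivAt_const t m)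
    exact ((((HasDerivAt.fun_sum fun i (_ : i ∈ Finset.univ) =>
      hq (hΛd t ht) (x i)).const_mul (1 / (N:ℝ))).add
      (hq (A := fun s => Γ s - Λ s) (fun i j => (hΓd t ht i j).sub (hΛd t ht i j)) m)).add
      hγm).add (hχd t ht)
  · have hL := dotProduct_mulVec_of_riccati (hΛsymm t) σ (hΛeq t ht)
    have hG := dotProduct_mulVec_of_riccati (hΓsymm t) σ (hΓeq t ht)
    have hχ := hχeq t ht
    have hγ := congrArg (fun v => v ⬝ᵥ ((N:ℝ)⁻¹ • ∑ i, x i)) (hγeq t ht)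
    have hmean := sum_dotProduct_mulVec_eq_mean hN0 x
    simp only [lqAnsatzGrad, lqAnsatzHess]
    set m := (N:ℝ)⁻¹ • ∑ i, x i with hm
    have hterm : ∀ i, ((b0 + B.mulVec (x i) + Bbar.mulVec m) ⬝ᵥ ((N:ℝ)⁻¹ • ((2:ℝ) •
          (Λ t).mulVec (x i) + (2:ℝ) • (Γ t - Λ t).mulVec m + γ t))
        - ((N:ℝ)/2) * (σ ⬝ᵥ ((N:ℝ)⁻¹ • ((2:ℝ) •
          (Λ t).mulVec (x i) + (2:ℝ) • (Γ t - Λ t).mulVec m + γ t)))^2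
        + (1/2) * (σ ⬝ᵥ ((N:ℝ)⁻¹ • ((2:ℝ) • Λ t + (2 * (N:ℝ)⁻¹) • (Γ t - Λ t))).mulVec σ))
      = (N:ℝ)⁻¹ * (-((x i) ⬝ᵥ (Λ' t).mulVec (x i))
        + 2 * ((b0 + Bbar.mulVec m) ⬝ᵥ (Λ t).mulVec (x i))
        + ((2:ℝ) • (Γ t - Λ t).mulVec m + γ t) ⬝ᵥ B.mulVec (x i)
        - 2 * (σ ⬝ᵥ ((2:ℝ) • (Γ t - Λ t).mulVec m + γ t)) * (σ ⬝ᵥ (Λ t).mulVec (x i))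
        + ((b0 + Bbar.mulVec m) ⬝ᵥ ((2:ℝ) • (Γ t - Λ t).mulVec m + γ t)
          - (σ ⬝ᵥ ((2:ℝ) • (Γ t - Λ t).mulVec m + γ t)) ^ 2 / 2
          + σ ⬝ᵥ (Λ t).mulVec σ + (N:ℝ)⁻¹ * (σ ⬝ᵥ (Γ t - Λ t).mulVec σ))) := by
      intro i
      rw [hL]
      generalize hw : (Γ t - Λ t).mulVec m = w
      simp only [dotProduct_add, add_dotProduct, dotProduct_smul, smul_dotProduct, smul_eq_mul,
        smul_mulVec, add_mulVec, dotProduct_comm (B.mulVec (x i))]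
      field_simp
      ring
    rw [Finset.sum_congr rfl fun i _ => hterm i, ← Finset.mul_sum]
    simp only [Finset.sum_add_distrib, Finset.sum_sub_distrib, Finset.sum_neg_distrib,
      ← Finset.mul_sum, hmean, Finset.sum_const, Finset.card_univ, Fintype.card_fin, nsmul_eq_mul]
    rw [sub_mulVec (Γ' t), dotProduct_sub, hG, hL m]
    simp only [sub_dotProduct, add_dotProduct, smul_dotProduct, zero_dotProduct, smul_eq_mul,
      mulVec_transpose, ← dotProduct_mulVec, ← mulVec_mulVec, add_mulVec] at hγ
    rw [dotProduct_comm ((Γ t).mulVec ((vecMulVec σ σ).mulVec (γ t))),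
      (hΓsymm t).dotProduct_mulVec_comm m, dotProduct_comm _ ((Γ t).mulVec m),
      dotProduct_mulVec_mulVec_vecMulVec, dotProduct_comm ((Γ t).mulVec b0) m,
      (hΓsymm t).dotProduct_mulVec_comm m b0] at hγ
    rw [dotProduct_mulVec_mulVec_vecMulVec] at hχ
    simp only [sub_mulVec, add_mulVec, dotProduct_add, add_dotProduct, dotProduct_sub,
      dotProduct_smul, smul_eq_mul,
      dotProduct_comm _ (B.mulVec m), dotProduct_comm _ (Bbar.mulVec m),
      dotProduct_comm _ b0] at hγ hχ ⊢
    field_simp at hχ ⊢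
    linear_combination (-2 * (N:ℝ)) * hγ - hχ
  · simp only [lqAnsatz, hΛT, hΓT, hγT, hχT, add_sub_cancel_left, Finset.sum_add_distrib,
      ← dotProduct_sum, dotProduct_smul, smul_eq_mul]
    ring
end

section
/- (Reduction of the $dN\times dN$ Riccati system to the decoupled Riccati equations.) Let $N \ge 1$, $d \ge 1$, $T > 0$, $b_0, p_1, \sigma \in \mathbb{R}^d$, $p_2 \in \mathbb{R}$, and $B, \bar B, P_2, \bar P_2 \in \mathbb{R}^{d\times d}$. Suppose the differentiable functions $\bar\Lambda, \hat\Lambda : [0,T] \to \mathbb{R}^{d\times d}$, $\bar\gamma : [0,T] \to \mathbb{R}^d$, $\chi_N : [0,T] \to \mathbb{R}$ satisfy on $[0,T]$: (i) $\bar\Lambda' + \bar\Lambda(\bar B + B) + \tfrac{1}{N}(\hat\Lambda - \bar\Lambda)\bar B + (B + \bar B)^\top \bar\Lambda + \tfrac{1}{N}\bar B^\top(\hat\Lambda - \bar\Lambda) - 2N\big[(N-2)\bar\Lambda \sigma\sigma^\top \bar\Lambda^\top + \hat\Lambda \sigma\sigma^\top \bar\Lambda^\top + \bar\Lambda \sigma\sigma^\top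 \hat\Lambda^\top\big] = 0$ with $\bar\Lambda(T) = \tfrac{1}{N^2}\bar P_2$; (ii) $\hat\Lambda' + (1 - \tfrac{1}{N})\bar\Lambda \bar B + (1 - \tfrac{1}{N})\bar B^\top \bar\Lambda + \hat\Lambda(\tfrac{\bar B}{N} + B) + (\tfrac{\bar B}{N} + B)^\top \hat\Lambda - 2N\big[(N-1)\bar\Lambda \sigma\sigma^\top \bar\Lambda^\top + \hat\Lambda \sigma\sigma^\top \hat\Lambda^\top\big] = 0$ with $\hat\Lambda(T) = \tfrac{1}{N^2}\bar P_2 + \tfrac{1}{N}P_2$; (iii) $\bar\gamma' + (\bar B + B)^\top \bar\gamma - 2N\big[(N-1)\bar\Lambda + \hat\Lambda\big]\sigma\sigma^\top \bar\gamma + 2\big[(N-1)\bar\Lambda + \hat\Lambda\big] b_0 = 0$ with $\bar\gamma(T) = p_1/N$; (iv) $\chi_N' - \tfrac{N^2}{2}\bar\gamma^\top \sigma\sigma^\top \bar\gamma + N \bar\gamma \cdot b_0 + N \sigma^\top \hat\Lambda \sigma = 0$ with $\chi_N(T) = p_2$. Then the functions $\tilde\Lambda := N(\hat\Lambda - \bar\Lambda)$,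 $\tilde\Gamma := N(N-1)\bar\Lambda + N\hat\Lambda$, $\tilde\gamma := N\bar\gamma$ and $\tilde\chi := \chi_N$ satisfy on $[0,T]$: $\tilde\Lambda' + \tilde\Lambda B + B^\top \tilde\Lambda - 2\tilde\Lambda \sigma\sigma^\top \tilde\Lambda^\top = 0$ with $\tilde\Lambda(T) = P_2$; $\tilde\Gamma' + \tilde\Gamma(B + \bar B) + (B + \bar B)^\top \tilde\Gamma - 2\tilde\Gamma \sigma\sigma^\top \tilde\Gamma^\top = 0$ with $\tilde\Gamma(T) = P_2 + \bar P_2$; $\tilde\gamma' + (B + \bar B)^\top \tilde\gamma - 2\tilde\Gamma \sigma\sigma^\top \tilde\gamma + 2\tilde\Gamma b_0 = 0$ with $\tilde\gamma(T) = p_1$; and $\tilde\chi' - \tfrac{1}{2}\tilde\gamma^\top \sigma\sigma^\top \tilde\gamma + \tilde\gamma \cdot b_0 + \sigma^\top \tilde\Lambda \sigma + \tfrac{1}{N}\sigma^\top(\tilde\Gamma - \tilde\Lambda)\sigma = 0$ with $\tilde\chi(T) = p_2$. -/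
open Matrix Set

/-- Reduction of the `dN×dN` Riccati system to the decoupled Riccati
equations.  If `Λ̄, Λ̂, γ̄, χ_N` solve the coupled system (i)–(iv) arising from the block
ansatz for the `dN×dN` matrix Riccati equation, then `Λ̃ := N(Λ̂-Λ̄)`,
`Γ̃ := N(N-1)Λ̄ + NΛ̂`, `γ̃ := Nγ̄`, `χ̃ := χ_N` solve the decoupled Riccati system. -/
theorem block_riccati_reduction
    (N d : ℕ) (hN : 1 ≤ N) (hd : 1 ≤ d) (T : ℝ) (hT : 0 < T)
    (b0 p1 σ : Fin d → ℝ) (p2 : ℝ)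
    (B Bbar P2 P2bar : Matrix (Fin d) (Fin d) ℝ)
    (Λbar Λhat : ℝ → Matrix (Fin d) (Fin d) ℝ) (γbar : ℝ → Fin d → ℝ) (χN : ℝ → ℝ)
    -- derivative data
    (Λbar' Λhat' : ℝ → Matrix (Fin d) (Fin d) ℝ) (γbar' : ℝ → Fin d → ℝ) (χN' : ℝ → ℝ)
    (hΛbard : ∀ t ∈ Icc (0:ℝ) T, ∀ i j, HasDerivAt (fun s => Λbar s i j) (Λbar' t i j) t)
    (hΛhatd : ∀ t ∈ Icc (0:ℝ) T, ∀ i j, HasDerivAt (fun s => Λhat s i j) (Λhat' t i j) t)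
    (hγbard : ∀ t ∈ Icc (0:ℝ) T, ∀ i, HasDerivAt (fun s => γbar s i) (γbar' t i) t)
    (hχNd : ∀ t ∈ Icc (0:ℝ) T, HasDerivAt χN (χN' t) t)
    -- (i)
    (h1 : ∀ t ∈ Icc (0:ℝ) T,
      Λbar' t + Λbar t * (Bbar + B) + ((N:ℝ)⁻¹) • ((Λhat t - Λbar t) * Bbar)
        + (B + Bbar)ᵀ * Λbar t + ((N:ℝ)⁻¹) • (Bbarᵀ * (Λhat t - Λbar t))
        - (2*(N:ℝ)) • (((N:ℝ)-2) • (Λbar t * vecMulVec σ σ * (Λbar t)ᵀ)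
            + Λhat t * vecMulVec σ σ * (Λbar t)ᵀ + Λbar t * vecMulVec σ σ * (Λhat t)ᵀ) = 0)
    (h1T : Λbar T = (((N:ℝ)^2)⁻¹) • P2bar)
    -- (ii)
    (h2 : ∀ t ∈ Icc (0:ℝ) T,
      Λhat' t + (1 - (N:ℝ)⁻¹) • (Λbar t * Bbar) + (1 - (N:ℝ)⁻¹) • (Bbarᵀ * Λbar t)
        + Λhat t * ((N:ℝ)⁻¹ • Bbar + B) + ((N:ℝ)⁻¹ • Bbar + B)ᵀ * Λhat t
        - (2*(N:ℝ)) • (((N:ℝ)-1) • (Λbar t * vecMulVec σ σ * (Λbar t)ᵀ)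
            + Λhat t * vecMulVec σ σ * (Λhat t)ᵀ) = 0)
    (h2T : Λhat T = (((N:ℝ)^2)⁻¹) • P2bar + ((N:ℝ)⁻¹) • P2)
    -- (iii)
    (h3 : ∀ t ∈ Icc (0:ℝ) T,
      γbar' t + (Bbar + B)ᵀ.mulVec (γbar t)
        - (2*(N:ℝ)) • (((((N:ℝ)-1) • Λbar t + Λhat t) * vecMulVec σ σ).mulVec (γbar t))
        + (2:ℝ) • ((((N:ℝ)-1) • Λbar t + Λhat t).mulVec b0) = 0)
    (h3T : γbar T = ((N:ℝ)⁻¹) • p1)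
    -- (iv)
    (h4 : ∀ t ∈ Icc (0:ℝ) T,
      χN' t - ((N:ℝ)^2/2) * ((γbar t) ⬝ᵥ (vecMulVec σ σ).mulVec (γbar t))
        + (N:ℝ) * ((γbar t) ⬝ᵥ b0) + (N:ℝ) * (σ ⬝ᵥ (Λhat t).mulVec σ) = 0)
    (h4T : χN T = p2) :
    -- the decoupled Riccati system for Λ̃, Γ̃, γ̃, χ̃
    ∃ (dΛ dΓ : ℝ → Matrix (Fin d) (Fin d) ℝ) (dγ : ℝ → Fin d → ℝ) (dχ : ℝ → ℝ),
      (∀ t ∈ Icc (0:ℝ) T, ∀ i j,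
        HasDerivAt (fun s => ((N:ℝ) • (Λhat s - Λbar s)) i j) (dΛ t i j) t) ∧
      (∀ t ∈ Icc (0:ℝ) T,
        dΛ t + ((N:ℝ) • (Λhat t - Λbar t)) * B + Bᵀ * ((N:ℝ) • (Λhat t - Λbar t))
          - (2:ℝ) • (((N:ℝ) • (Λhat t - Λbar t)) * vecMulVec σ σ
              * ((N:ℝ) • (Λhat t - Λbar t))ᵀ) = 0) ∧
      ((N:ℝ) • (Λhat T - Λbar T) = P2) ∧
      (∀ t ∈ Icc (0:ℝ) T, ∀ i j,
        HasDerivAt (fun s => (((N:ℝ)*((N:ℝ)-1)) • Λbar s + (N:ℝ) • Λhat s) i j) (dΓ t i j) t) ∧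
      (∀ t ∈ Icc (0:ℝ) T,
        dΓ t + (((N:ℝ)*((N:ℝ)-1)) • Λbar t + (N:ℝ) • Λhat t) * (B + Bbar)
          + (B + Bbar)ᵀ * (((N:ℝ)*((N:ℝ)-1)) • Λbar t + (N:ℝ) • Λhat t)
          - (2:ℝ) • ((((N:ℝ)*((N:ℝ)-1)) • Λbar t + (N:ℝ) • Λhat t) * vecMulVec σ σ
              * (((N:ℝ)*((N:ℝ)-1)) • Λbar t + (N:ℝ) • Λhat t)ᵀ) = 0) ∧
      (((N:ℝ)*((N:ℝ)-1)) • Λbar T + (N:ℝ) • Λhat T = P2 + P2bar) ∧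
      (∀ t ∈ Icc (0:ℝ) T, ∀ i,
        HasDerivAt (fun s => ((N:ℝ) • γbar s) i) (dγ t i) t) ∧
      (∀ t ∈ Icc (0:ℝ) T,
        dγ t + (B + Bbar)ᵀ.mulVec ((N:ℝ) • γbar t)
          - (2:ℝ) • (((((N:ℝ)*((N:ℝ)-1)) • Λbar t + (N:ℝ) • Λhat t)
              * vecMulVec σ σ).mulVec ((N:ℝ) • γbar t))
          + (2:ℝ) • ((((N:ℝ)*((N:ℝ)-1)) • Λbar t + (N:ℝ) • Λhat t).mulVec b0) = 0) ∧
      ((N:ℝ) • γbar T = p1) ∧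
      (∀ t ∈ Icc (0:ℝ) T, HasDerivAt χN (dχ t) t) ∧
      (∀ t ∈ Icc (0:ℝ) T,
        dχ t - (1/2) * (((N:ℝ) • γbar t) ⬝ᵥ (vecMulVec σ σ).mulVec ((N:ℝ) • γbar t))
          + ((N:ℝ) • γbar t) ⬝ᵥ b0 + σ ⬝ᵥ ((N:ℝ) • (Λhat t - Λbar t)).mulVec σ
          + (1/(N:ℝ)) * (σ ⬝ᵥ ((((N:ℝ)*((N:ℝ)-1)) • Λbar t + (N:ℝ) • Λhat t)
              - (N:ℝ) • (Λhat t - Λbar t)).mulVec σ) = 0) ∧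
      (χN T = p2) := by
  have hn : (N : ℝ) ≠ 0 := by exact_mod_cast (by omega : N ≠ 0)
  refine ⟨fun t => (N : ℝ) • (Λhat' t - Λbar' t),
    fun t => ((N : ℝ) * ((N : ℝ) - 1)) • Λbar' t + (N : ℝ) • Λhat' t,
    fun t => (N : ℝ) • γbar' t, χN', ?_, ?_, ?_, ?_, ?_, ?_, ?_, ?_, ?_, hχNd, ?_, h4T⟩
  · intro t ht i j
    exact ((hΛhatd t ht i j).sub (hΛbard t ht i j)).const_mul (N : ℝ)
  · intro t ht
    linear_combination (norm := skip) (N : ℝ) • (h2 t ht - h1 t ht)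
    simp only [mul_add, add_mul, mul_sub, sub_mul, transpose_add, transpose_sub, transpose_smul,
      smul_mul_assoc, mul_smul_comm]
    match_scalars <;> field_simp <;> ring
  · rw [h1T, h2T]
    match_scalars <;> field_simp <;> ring
  · intro t ht i j
    exact ((hΛbard t ht i j).const_mul ((N : ℝ) * ((N : ℝ) - 1))).add
      ((hΛhatd t ht i j).const_mul (N : ℝ))
  · intro t ht
    linear_combination (norm := skip)
      ((N : ℝ) * ((N : ℝ) - 1)) • h1 t ht + (N : ℝ) • h2 t ht
    simp only [mul_add, add_mul, mul_sub, sub_mul, transpose_add, transpose_sub, transpose_smul,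
      smul_mul_assoc, mul_smul_comm]
    match_scalars <;> field_simp <;> ring
  · rw [h1T, h2T]
    match_scalars <;> field_simp <;> ring
  · intro t ht i
    exact (hγbard t ht i).const_mul (N : ℝ)
  · intro t ht
    linear_combination (norm := skip) (N : ℝ) • h3 t ht
    simp only [add_mul, transpose_add, smul_mul_assoc, add_mulVec, smul_mulVec, mulVec_smul]
    match_scalars <;> ring
  · rw [h3T, smul_inv_smul₀ hn]
  · intro t ht
    linear_combination (norm := skip) h4 t ht
    simp only [add_mulVec, sub_mulVec, smul_mulVec, mulVec_smul, dotProduct_add, dotProduct_sub,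
      dotProduct_smul, smul_dotProduct, smul_eq_mul]
    field_simp
    ring
end

section
/- (The importance sampling estimator of Example 3.1 is deterministic, with zero relative error.) Let $N \ge 1$, $s \le T$ be real numbers, $\sigma \in \mathbb{R}$, $y_1,\dots,y_N \in \mathbb{R}$, and let $\hat W^1,\dots,\hat W^N : [s,T] \to \mathbb{R}$ be functions with $\hat W^i_s = 0$. Suppose $\hat X^1,\dots,\hat X^N : [s,T] \to \mathbb{R}$ are continuous functions satisfying, for every $i$ and every $t \in [s,T]$, the controlled integral equation $\hat X^i_t = y_i + \int_s^t \Big( \hat X^i_\tau - \frac{1}{N}\sum_{j=1}^N \hat X^j_\tau - \sigma^2 \Big)\, d\tau + \sigma \hat W^i_t$. Then $\exp\Big(-\sum_{i=1}^N \hat X^i_T\Big)\, \prod_{i=1}^N \exp\Big( \sigma \hat W^i_T - \tfrac{\sigma^2}{2}(T-s) \Big) = \exp\Big( -\sum_{i=1}^N y_i + \tfrac{N\sigma^2}{2}(T-s) \Big)$; in particular, the left-hand side does not depend on the paths $\hat W^1,\dots,\hat W^N$ and equals the target expectation $\mathbb{E}[\exp(-N G(\mu^{N}_T))] = \exp(-\sum_i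 y_i)\exp(N\sigma^2(T-s)/2)$ of the uncontrolled system, so the importance sampling estimator has zero variance. -/
open Set intervalIntegral

/-- The importance sampling estimator of Example 3.1 is deterministic, with
zero relative error.  For the controlled particle system
`X̂^i_t = y_i + ∫_s^t (X̂^i_τ - N⁻¹ ∑_j X̂^j_τ - σ²) dτ + σ Ŵ^i_t`, the importance sampling
estimator `exp(-∑_i X̂^i_T) ∏_i exp(σ Ŵ^i_T - σ²(T-s)/2)` equals the deterministic value
`exp(-∑_i y_i + Nσ²(T-s)/2)`, independently of the driving paths. -/
theorem importance_sampling_estimator_deterministic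
    (N : ℕ) (hN : 1 ≤ N) (s T : ℝ) (hsT : s ≤ T) (σ : ℝ)
    (y : Fin N → ℝ) (W X : Fin N → ℝ → ℝ)
    (hW0 : ∀ i, W i s = 0)
    (hXcont : ∀ i, ContinuousOn (X i) (Icc s T))
    (hX : ∀ i, ∀ t ∈ Icc s T,
      X i t = y i + (∫ τ in s..t, (X i τ - (N:ℝ)⁻¹ * ∑ j, X j τ - σ^2)) + σ * W i t) :
    Real.exp (-(∑ i, X i T)) * ∏ i, Real.exp (σ * W i T - σ^2 / 2 * (T - s))
      = Real.exp (-(∑ i, y i) + (N:ℝ) * σ^2 / 2 * (T - s)) := by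
  have hN0 : (N : ℝ) ≠ 0 := by positivity
  have hint : ∀ i ∈ Finset.univ, IntervalIntegrable
      (fun τ => X i τ - (N:ℝ)⁻¹ * ∑ j, X j τ - σ^2) MeasureTheory.volume s T := by
    intro i _
    apply ContinuousOn.intervalIntegrable
    rw [uIcc_of_le hsT]
    exact ((hXcont i).sub (continuousOn_const.mul
      (continuousOn_finsetSum _ fun j _ => hXcont j))).sub continuousOn_const
  have hdrift : ∑ i, ∫ τ in s..T, (X i τ - (N:ℝ)⁻¹ * ∑ j, X j τ - σ^2)
      = -(N * σ^2 * (T - s)) := by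
    rw [← integral_finsetSum hint]
    have hmean : ∀ τ, ∑ i, (X i τ - (N:ℝ)⁻¹ * ∑ j, X j τ - σ^2) = -(N * σ^2) := by
      intro τ
      simp [Finset.sum_sub_distrib, hN0]
    simp only [hmean, integral_const, smul_eq_mul]
    ring
  have hsum : ∑ i, X i T = ∑ i, y i - N * σ^2 * (T - s) + σ * ∑ i, W i T := by
    rw [Finset.sum_congr rfl fun i _ => hX i T (right_mem_Icc.2 hsT), Finset.sum_add_distrib,
      Finset.sum_add_distrib, hdrift, Finset.mul_sum]
    ring
  rw [← Real.exp_sum, ← Real.exp_add, hsum, Finset.sum_sub_distrib, ← Finset.mul_sum]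
  congr 1
  simp only [Finset.sum_const, Finset.card_univ, Fintype.card_fin, nsmul_eq_mul]
  ring
end
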